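/- arXiv:2209.15154 — 5 statements merged into one kernel-verified Lean document; each statement's English description precedes it below -/
import Mathlib

section
/- For every integer K ≥ 2, there exist a probability space (Ω, ℱ, P) and random variables S : Ω → ℝ with values in the interval [1/K, 1], Y : Ω → {0,1}, and V : Ω → ℝ, such that the expected calibration error E[|E[Y | σ(S)] − S|] equals 0 while the variable-based expected calibration error E[|E[Y | σ(V)] − E[S | σ(V)]|] equals 1/2 − 1/(2K). -/
open MeasureTheory

/-- The Bernoulli law on `Bool` giving mass `p` to `true` and `1 - p` to `false`. -/
noncomputable def boolBernoulli (p : ℝ) : Measure Bool :=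
  ENNReal.ofReal p • Measure.dirac true + ENNReal.ofReal (1 - p) • Measure.dirac false

theorem isProbabilityMeasure_boolBernoulli {p : ℝ} (h0 : 0 ≤ p) (h1 : p ≤ 1) :
    IsProbabilityMeasure (boolBernoulli p) := by
  constructor
  simp [boolBernoulli, ← ENNReal.ofReal_add h0 (sub_nonneg.2 h1)]

theorem integral_boolBernoulli {p : ℝ} (h0 : 0 ≤ p) (h1 : p ≤ 1) (f : Bool → ℝ) :
    ∫ b, f b ∂boolBernoulli p = p * f true + (1 - p) * f false := by
  rw [boolBernoulli, integral_add_measure, integral_smul_measure, integral_smul_measure,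
    integral_dirac, integral_dirac, ENNReal.toReal_ofReal h0,
    ENNReal.toReal_ofReal (sub_nonneg.2 h1), smul_eq_mul, smul_eq_mul]
  · exact (integrable_dirac (by simp)).smul_measure ENNReal.ofReal_ne_top
  · exact (integrable_dirac (by simp)).smul_measure ENNReal.ofReal_ne_top

/-- The larger root of `p * (1 - p) = (1 - 1 / k) / 4` lies in `[k⁻¹, 1]`. -/
theorem exists_mul_one_sub_eq {k : ℝ} (hk : 2 ≤ k) :
    ∃ p ∈ Set.Icc k⁻¹ 1, p * (1 - p) = (1 - 1 / k) / 4 := by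
  have hk1 : k⁻¹ ≤ 1 / 2 := by
    rw [one_div]; exact inv_anti₀ two_pos hk
  have hs0 := Real.sqrt_nonneg k⁻¹
  have hs1 : √k⁻¹ ≤ 1 := Real.sqrt_le_one.2 (by linarith)
  have hsq : √k⁻¹ ^ 2 = k⁻¹ := Real.sq_sqrt (by positivity)
  refine ⟨(1 + √k⁻¹) / 2, ⟨by linarith, by linarith⟩, ?_⟩
  rw [one_div]
  linear_combination -hsq / 4

/-- **VECE bound (limit case).** For every integer `K ≥ 2`, there exist a probability
space `(Ω, ℱ, P)` and random variables `S : Ω → ℝ` with values in `[1/K, 1]`,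
`Y : Ω → {0,1}` and `V : Ω → ℝ` such that the expected calibration error
`E[|E[Y | σ(S)] − S|]` equals `0` while the variable-based expected calibration error
`E[|E[Y | σ(V)] − E[S | σ(V)]|]` equals `1/2 − 1/(2K)`. -/
theorem vece_bound (K : ℤ) (hK : 2 ≤ K) :
    ∃ (Ω : Type) (_ : MeasurableSpace Ω) (P : Measure Ω) (_ : IsProbabilityMeasure P)
      (S Y V : Ω → ℝ),
      Measurable S ∧ Measurable Y ∧ Measurable V ∧
      (∀ ω, S ω ∈ Set.Icc ((K : ℝ)⁻¹) 1) ∧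
      (∀ ω, Y ω = 0 ∨ Y ω = 1) ∧
      (∫ ω, |(P[Y | MeasurableSpace.comap S Real.measurableSpace]) ω - S ω| ∂P) = 0 ∧
      (∫ ω, |(P[Y | MeasurableSpace.comap V Real.measurableSpace]) ω
              - (P[S | MeasurableSpace.comap V Real.measurableSpace]) ω| ∂P)
        = 1 / 2 - 1 / (2 * (K : ℝ)) := by
  have hk : (2 : ℝ) ≤ K := by exact_mod_cast hK
  obtain ⟨p, ⟨hpK, hp1⟩, hp⟩ := exists_mul_one_sub_eq hk
  have hp0 : 0 ≤ p := le_trans (by positivity) hpK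
  have hP := isProbabilityMeasure_boolBernoulli hp0 hp1
  let Y : Bool → ℝ := fun b => if b then 1 else 0
  have hY : Measurable Y := measurable_of_finite Y
  refine ⟨Bool, inferInstance, boolBernoulli p, hP, fun _ => p, Y, Y, measurable_const, hY, hY,
    fun _ => ⟨hpK, hp1⟩, fun b => by cases b <;> simp [Y], ?_, ?_⟩
  · rw [MeasurableSpace.comap_const, condExp_bot]
    simp [integral_boolBernoulli hp0 hp1, Y]
  · rw [condExp_const hY.comap_le, condExp_of_stronglyMeasurable hY.comap_le
      (comap_measurable Y).stronglyMeasurable .of_finite, integral_boolBernoulli hp0 hp1]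
    simp only [Y, if_true, Bool.false_eq_true, if_false, zero_sub, abs_neg, abs_of_nonneg hp0,
      abs_of_nonneg (sub_nonneg.2 hp1)]
    have hd : 1 / (2 * (K : ℝ)) = 1 / K / 2 := by ring
    rw [hd]
    linear_combination 2 * hp
end

section
/- For every integer K ≥ 2, there exist a probability space (Ω, ℱ, P) and random variables S : Ω → ℝ with values in the interval [1/K, 1], Y : Ω → {0,1}, and V : Ω → ℝ, such that the variable-based expected calibration error E[|E[Y | σ(V)] − E[S | σ(V)]|] equals 0 while the expected calibration error E[|E[Y | σ(S)] − S|] equals 1/2 − 1/(2K). -/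
open MeasureTheory

/-- The integral against a two-point measure on `Bool` is the weighted sum of the two values. -/
lemma integral_ofReal_smul_dirac_bool {p q : ℝ} (hp : 0 ≤ p) (hq : 0 ≤ q) (f : Bool → ℝ) :
    ∫ ω, f ω ∂(ENNReal.ofReal p • Measure.dirac true + ENNReal.ofReal q • Measure.dirac false)
      = p * f true + q * f false := by
  rw [integral_add_measure ((integrable_dirac (by simp)).smul_measure ENNReal.ofReal_ne_top)
    ((integrable_dirac (by simp)).smul_measure ENNReal.ofReal_ne_top)]
  simp [integral_smul_measure, hp, hq]

/-- **ECE bound (limit case).** For every integer `K ≥ 2`, there exist a probability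
space `(Ω, ℱ, P)` and random variables `S : Ω → ℝ` with values in `[1/K, 1]`,
`Y : Ω → {0,1}` and `V : Ω → ℝ` such that the variable-based expected calibration
error `E[|E[Y | σ(V)] − E[S | σ(V)]|]` equals `0` while the expected calibration
error `E[|E[Y | σ(S)] − S|]` equals `1/2 − 1/(2K)`. -/
theorem ece_bound (K : ℤ) (hK : 2 ≤ K) :
    ∃ (Ω : Type) (_ : MeasurableSpace Ω) (P : Measure Ω) (_ : IsProbabilityMeasure P)
      (S Y V : Ω → ℝ),
      Measurable S ∧ Measurable Y ∧ Measurable V ∧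
      (∀ ω, S ω ∈ Set.Icc ((K : ℝ)⁻¹) 1) ∧
      (∀ ω, Y ω = 0 ∨ Y ω = 1) ∧
      (∫ ω, |(P[Y | MeasurableSpace.comap V Real.measurableSpace]) ω
              - (P[S | MeasurableSpace.comap V Real.measurableSpace]) ω| ∂P) = 0 ∧
      (∫ ω, |(P[Y | MeasurableSpace.comap S Real.measurableSpace]) ω - S ω| ∂P)
        = 1 / 2 - 1 / (2 * (K : ℝ)) := by
  set c : ℝ := (K : ℝ)⁻¹ with hc
  have hK' : (2 : ℝ) ≤ K := by exact_mod_cast hK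
  have hc0 : 0 < c := by positivity
  have hc1 : c < 1 := inv_lt_one_of_one_lt₀ (by linarith)
  have hp : 0 ≤ (3 + c) / 4 := by linarith
  have hq : 0 ≤ (1 - c) / 4 := by linarith
  have ha1 : (2 + 2 * c) / (3 + c) < 1 := by
    rw [div_lt_one (by linarith)]
    linarith
  have hac : c ≤ (2 + 2 * c) / (3 + c) := by
    rw [le_div_iff₀ (by linarith)]
    nlinarith
  set S : Bool → ℝ := fun ω => if ω then (2 + 2 * c) / (3 + c) else 1 with hS
  set Y : Bool → ℝ := fun ω => if ω then 1 else 0 with hY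
  set P : Measure Bool := ENNReal.ofReal ((3 + c) / 4) • Measure.dirac true
    + ENNReal.ofReal ((1 - c) / 4) • Measure.dirac false with hP
  have hprob : IsProbabilityMeasure P := by
    constructor
    simp only [hP, Measure.add_apply, Measure.smul_apply, measure_univ, smul_eq_mul, mul_one]
    rw [← ENNReal.ofReal_add hp hq, ENNReal.ofReal_eq_one]
    ring
  have hSm : Measurable S := measurable_from_top
  have hYS : Y = (Set.Iio (1 : ℝ)).indicator 1 ∘ S := by
    funext ω
    cases ω <;> simp [hY, hS, ha1]
  have hYm : StronglyMeasurable[MeasurableSpace.comap S Real.measurableSpace] Y := by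
    rw [hYS]
    exact ((measurable_one.indicator measurableSet_Iio).comp
      (comap_measurable S)).stronglyMeasurable
  refine ⟨Bool, inferInstance, P, hprob, S, Y, fun _ => 0, hSm, measurable_from_top,
    measurable_const, ?_, ?_, ?_, ?_⟩
  · intro ω
    cases ω
    · simp [hS, hc1.le]
    · simp [hS, hac, ha1.le]
  · intro ω
    cases ω <;> simp [hY]
  · have hYS_mean : ∫ ω, Y ω ∂P = ∫ ω, S ω ∂P := by
      rw [hP, integral_ofReal_smul_dirac_bool hp hq, integral_ofReal_smul_dirac_bool hp hq]
      simp only [hS, hY, if_true, Bool.false_eq_true, if_false]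
      field_simp
      ring
    simp [MeasurableSpace.comap_const, condExp_bot, hYS_mean]
  · rw [condExp_of_stronglyMeasurable hSm.comap_le hYm .of_finite, hP,
      integral_ofReal_smul_dirac_bool hp hq]
    simp only [hS, hY, if_true, Bool.false_eq_true, if_false]
    rw [abs_of_pos (by linarith), zero_sub, abs_neg, abs_one,
      show 1 / (2 * (K : ℝ)) = c / 2 by rw [hc]; ring]
    field_simp
    ring
end

section
/- For every integer K ≥ 2 and every real α with 0 < α ≤ 1/4, there exist a probability space (Ω, ℱ, P) and random variables S : Ω → ℝ with values in [1/K, 1], Y : Ω → {0,1}, and V : Ω → ℝ, such that the variable-based expected calibration error E[|E[Y | σ(V)] − E[S | σ(V)]|] equals 0 while the expected calibration error E[|E[Y | σ(S)] − S|] equals 1/2 − 1/(2K) − α/2. -/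
open MeasureTheory

/-- The measure on `Bool` with mass `p` at `true` and mass `1 - p` at `false`. -/
noncomputable def twoPointMeasure (p : ℝ) : Measure Bool :=
  ENNReal.ofReal p • Measure.dirac true + ENNReal.ofReal (1 - p) • Measure.dirac false

lemma isProbabilityMeasure_twoPointMeasure {p : ℝ} (h0 : 0 ≤ p) (h1 : p ≤ 1) :
    IsProbabilityMeasure (twoPointMeasure p) := by
  constructor
  simp [twoPointMeasure, ← ENNReal.ofReal_add h0 (sub_nonneg.2 h1)]

lemma integral_twoPointMeasure {p : ℝ} (h0 : 0 ≤ p) (h1 : p ≤ 1) (f : Bool → ℝ) :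
    ∫ b, f b ∂(twoPointMeasure p) = p * f true + (1 - p) * f false := by
  have h1' : 0 ≤ 1 - p := sub_nonneg.2 h1
  have hf (b : Bool) : Integrable f (Measure.dirac b) := .of_finite
  rw [twoPointMeasure, integral_add_measure ((hf _).smul_measure ENNReal.ofReal_ne_top)
    ((hf _).smul_measure ENNReal.ofReal_ne_top)]
  simp [h0, h1']

/-- **ECE bound (quantitative version).** For every integer `K ≥ 2` and every real
`α` with `0 < α ≤ 1/4`, there exist a probability space `(Ω, ℱ, P)` and random
variables `S : Ω → ℝ` with values in `[1/K, 1]`, `Y : Ω → {0,1}` and `V : Ω → ℝ`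
such that the variable-based expected calibration error
`E[|E[Y | σ(V)] − E[S | σ(V)]|]` equals `0` while the expected calibration error
`E[|E[Y | σ(S)] − S|]` equals `1/2 − 1/(2K) − α/2`. -/
theorem ece_bound_quantitative (K : ℤ) (hK : 2 ≤ K) (α : ℝ) (hα : 0 < α) (hα' : α ≤ 1 / 4) :
    ∃ (Ω : Type) (_ : MeasurableSpace Ω) (P : Measure Ω) (_ : IsProbabilityMeasure P)
      (S Y V : Ω → ℝ),
      Measurable S ∧ Measurable Y ∧ Measurable V ∧
      (∀ ω, S ω ∈ Set.Icc ((K : ℝ)⁻¹) 1) ∧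
      (∀ ω, Y ω = 0 ∨ Y ω = 1) ∧
      (∫ ω, |(P[Y | MeasurableSpace.comap V Real.measurableSpace]) ω
              - (P[S | MeasurableSpace.comap V Real.measurableSpace]) ω| ∂P) = 0 ∧
      (∫ ω, |(P[Y | MeasurableSpace.comap S Real.measurableSpace]) ω - S ω| ∂P)
        = 1 / 2 - 1 / (2 * (K : ℝ)) - α / 2 := by
  have hK' : (2 : ℝ) ≤ K := by exact_mod_cast hK
  have hinv : (K : ℝ)⁻¹ ≤ 1 / 2 := by
    rw [one_div]
    exact inv_anti₀ two_pos hK'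
  have hinv0 : 0 < (K : ℝ)⁻¹ := inv_pos.2 (two_pos.trans_le hK')
  have hmul : 1 / (2 * (K : ℝ)) = (K : ℝ)⁻¹ / 2 := by
    rw [one_div, mul_inv]
    ring
  rw [hmul]
  generalize (K : ℝ)⁻¹ = k at *
  have hp0 : (0 : ℝ) ≤ (1 + k) / 2 := by linarith
  have hp1 : (1 + k) / 2 ≤ (1 : ℝ) := by linarith
  have hh0 : (0 : ℝ) ≤ 1 / 2 := by norm_num
  have hh1 : (1 / 2 : ℝ) ≤ 1 := by norm_num
  let μ := twoPointMeasure (1 / 2)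
  let ν := twoPointMeasure ((1 + k) / 2)
  have : IsProbabilityMeasure μ := isProbabilityMeasure_twoPointMeasure hh0 hh1
  have : IsProbabilityMeasure ν := isProbabilityMeasure_twoPointMeasure hp0 hp1
  let s : Bool → ℝ := fun b => if b then 1 - α / 2 else k + α / 2
  let y : Bool → ℝ := fun b => if b then 1 else 0
  have hs : Measurable s := measurable_of_finite s
  have hy : Measurable y := measurable_of_finite y
  have hS : Measurable fun ω : Bool × Bool => s ω.1 := hs.comp measurable_fst
  have hY : Measurable fun ω : Bool × Bool => y ω.2 := hy.comp measurable_snd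
  have hEY : ∫ ω, y ω.2 ∂(μ.prod ν) = (1 + k) / 2 := by
    rw [integral_fun_snd, probReal_univ, one_smul, integral_twoPointMeasure hp0 hp1]
    simp [y]
  have hES : ∫ ω, s ω.1 ∂(μ.prod ν) = (1 + k) / 2 := by
    rw [integral_fun_fst, probReal_univ, one_smul, integral_twoPointMeasure hh0 hh1]
    simp [s]
    ring
  refine ⟨Bool × Bool, inferInstance, μ.prod ν, inferInstance, fun ω => s ω.1,
    fun ω => y ω.2, fun _ => 0, hS, hY, measurable_const, ?_, ?_, ?_, ?_⟩
  · rintro ⟨b, c⟩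
    cases b <;> simp only [s, Set.mem_Icc] <;> constructor <;> norm_num <;> linarith
  · rintro ⟨b, c⟩
    cases c <;> simp [y]
  · rw [MeasurableSpace.comap_const, condExp_bot, condExp_bot, hEY, hES]
    simp
  · have hind : ProbabilityTheory.IndepFun (fun ω : Bool × Bool => y ω.2)
        (fun ω : Bool × Bool => s ω.1) (μ.prod ν) :=
      (ProbabilityTheory.indepFun_prod hs hy).symm
    have hcond := condExp_indep_eq hY.comap_le hS.comap_le
      (comap_measurable fun ω : Bool × Bool => y ω.2).stronglyMeasurable
      ((ProbabilityTheory.IndepFun_iff_Indep _ _ _).1 hind)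
    rw [hEY] at hcond
    calc _ = ∫ ω : Bool × Bool, |(1 + k) / 2 - s ω.1| ∂(μ.prod ν) := by
          refine integral_congr_ae ?_
          filter_upwards [hcond] with ω hω
          exact congrArg (fun x => |x - s ω.1|) hω
      _ = 1 / 2 - k / 2 - α / 2 := by
          rw [integral_fun_fst (fun b => |(1 + k) / 2 - s b|), probReal_univ, one_smul,
            integral_twoPointMeasure hh0 hh1]
          have htrue : |(1 + k) / 2 - s true| = (1 - k - α) / 2 := by
            rw [abs_of_nonpos] <;> simp only [s, if_true] <;> linarith
          have hfalse : |(1 + k) / 2 - s false| = (1 - k - α) / 2 := by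
            rw [abs_of_nonneg] <;> simp [s] <;> linarith
          rw [htrue, hfalse]
          ring
end

section
/- Let (Ω, ℱ, P) be a probability space carrying an integrable score random variable S : Ω → ℝ, a correctness indicator Y : Ω → {0,1}, and a variable of interest V : Ω → ℝ. If the classifier is consistently overconfident with respect both to its score and to V — that is, S > E[Y | σ(S)] almost surely and E[S | σ(V)] > E[Y | σ(V)] almost surely — then the expected calibration error E[|E[Y | σ(S)] − S|] and the variable-based expected calibration error E[|E[Y | σ(V)] − E[S | σ(V)]|] are equal, and both equal E[S] − P(Y = 1). -/
open MeasureTheory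

/-- If `f ≤ g` almost surely, then the mean absolute deviation is the difference of the means. -/
lemma integral_abs_sub_of_ae_le {Ω : Type*} [MeasurableSpace Ω] {P : Measure Ω} {f g : Ω → ℝ}
    (hf : Integrable f P) (hg : Integrable g P) (hfg : f ≤ᵐ[P] g) :
    ∫ ω, |f ω - g ω| ∂P = ∫ ω, g ω ∂P - ∫ ω, f ω ∂P := by
  rw [← integral_sub hg hf]
  refine integral_congr_ae ?_
  filter_upwards [hfg] with ω hω
  rw [abs_of_nonpos (sub_nonpos.2 hω), neg_sub]

/-- The mean of a `{0, 1}`-valued random variable is its probability of being `1`. -/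
lemma integral_eq_toReal_of_zero_or_one {Ω : Type*} [MeasurableSpace Ω] {P : Measure Ω}
    {Y : Ω → ℝ} (hY : Measurable Y) (hY01 : ∀ ω, Y ω = 0 ∨ Y ω = 1) :
    ∫ ω, Y ω ∂P = (P {ω | Y ω = 1}).toReal := by
  have hind : Y = Set.indicator {ω | Y ω = 1} 1 := by
    ext ω
    rcases hY01 ω with h | h <;> simp [Set.indicator, h]
  have hset : MeasurableSet {ω | Y ω = 1} := hY (measurableSet_singleton 1)
  calc ∫ ω, Y ω ∂P = ∫ ω, Set.indicator {ω | Y ω = 1} 1 ω ∂P := congrArg _ hind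
    _ = (P {ω | Y ω = 1}).toReal := integral_indicator_one hset

/-- **Equality of ECE and VECE under consistent overconfidence.** If the classifier
is consistently overconfident both with respect to its score `S` (i.e.
`S > E[Y | σ(S)]` a.s.) and with respect to the variable `V` (i.e.
`E[S | σ(V)] > E[Y | σ(V)]` a.s.), then the expected calibration error
`E[|E[Y | σ(S)] − S|]` and the variable-based expected calibration error
`E[|E[Y | σ(V)] − E[S | σ(V)]|]` are equal, and both equal `E[S] − P(Y = 1)`. -/
theorem ece_eq_vece_of_consistently_overconfident
    {Ω : Type} [MeasurableSpace Ω] (P : Measure Ω) [IsProbabilityMeasure P]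
    (S Y V : Ω → ℝ)
    (hS : Measurable S) (hY : Measurable Y) (hV : Measurable V)
    (hSint : Integrable S P)
    (hY01 : ∀ ω, Y ω = 0 ∨ Y ω = 1)
    (hOverS : ∀ᵐ ω ∂P, (P[Y | MeasurableSpace.comap S Real.measurableSpace]) ω < S ω)
    (hOverV : ∀ᵐ ω ∂P, (P[Y | MeasurableSpace.comap V Real.measurableSpace]) ω
                        < (P[S | MeasurableSpace.comap V Real.measurableSpace]) ω) :
    (∫ ω, |(P[Y | MeasurableSpace.comap S Real.measurableSpace]) ω - S ω| ∂P)
      = (∫ ω, |(P[Y | MeasurableSpace.comap V Real.measurableSpace]) ω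
                - (P[S | MeasurableSpace.comap V Real.measurableSpace]) ω| ∂P) ∧
    (∫ ω, |(P[Y | MeasurableSpace.comap S Real.measurableSpace]) ω - S ω| ∂P)
      = (∫ ω, S ω ∂P) - (P {ω | Y ω = 1}).toReal := by
  have hECE := integral_abs_sub_of_ae_le (integrable_condExp (f := Y)) hSint
    (hOverS.mono fun _ h => h.le)
  have hVECE := integral_abs_sub_of_ae_le (integrable_condExp (f := Y))
    (integrable_condExp (f := S)) (hOverV.mono fun _ h => h.le)
  rw [integral_condExp hS.comap_le] at hECE
  rw [integral_condExp hV.comap_le, integral_condExp hV.comap_le] at hVECE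
  exact ⟨hECE.trans hVECE.symm, by rw [hECE, integral_eq_toReal_of_zero_or_one hY hY01]⟩
end

section
/- Let (Ω, ℱ, P) be a probability space carrying an integrable score random variable S : Ω → ℝ, a correctness indicator Y : Ω → {0,1}, and a variable of interest V : Ω → ℝ. If the classifier is consistently underconfident with respect both to its score and to V — that is, S < E[Y | σ(S)] almost surely and E[S | σ(V)] < E[Y | σ(V)] almost surely — then the expected calibration error E[|E[Y | σ(S)] − S|] and the variable-based expected calibration error E[|E[Y | σ(V)] − E[S | σ(V)]|] are equal, and both equal P(Y = 1) − E[S]. -/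
open MeasureTheory

/-- If `f < g` almost surely, the integral of `|g - f|` is the difference of the integrals. -/
theorem integral_abs_sub_of_ae_lt {Ω : Type*} [MeasurableSpace Ω] {μ : Measure Ω} {f g : Ω → ℝ}
    (hf : Integrable f μ) (hg : Integrable g μ) (h : ∀ᵐ ω ∂μ, f ω < g ω) :
    ∫ ω, |g ω - f ω| ∂μ = ∫ ω, g ω ∂μ - ∫ ω, f ω ∂μ := by
  rw [← integral_sub hg hf]
  refine integral_congr_ae ?_
  filter_upwards [h] with ω hω
  exact abs_of_pos (sub_pos.2 hω)

/-- The integral of a `{0, 1}`-valued random variable is the probability that it equals `1`. -/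
theorem integral_eq_measure_eq_one {Ω : Type*} [MeasurableSpace Ω] {μ : Measure Ω} {Y : Ω → ℝ}
    (hY : Measurable Y) (hY01 : ∀ ω, Y ω = 0 ∨ Y ω = 1) :
    ∫ ω, Y ω ∂μ = (μ {ω | Y ω = 1}).toReal := by
  have hInd : Y = {ω | Y ω = 1}.indicator 1 := by
    ext ω
    rcases hY01 ω with h | h <;> simp [h]
  have hmeas : MeasurableSet {ω | Y ω = 1} := hY (measurableSet_singleton 1)
  calc ∫ ω, Y ω ∂μ = ∫ ω, {ω | Y ω = 1}.indicator 1 ω ∂μ := by rw [← hInd]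
    _ = (μ {ω | Y ω = 1}).toReal := integral_indicator_one hmeas

/-- **Equality of ECE and VECE under consistent underconfidence.** If the classifier
is consistently underconfident both with respect to its score `S` (i.e.
`S < E[Y | σ(S)]` a.s.) and with respect to the variable `V` (i.e.
`E[S | σ(V)] < E[Y | σ(V)]` a.s.), then the expected calibration error
`E[|E[Y | σ(S)] − S|]` and the variable-based expected calibration error
`E[|E[Y | σ(V)] − E[S | σ(V)]|]` are equal, and both equal `P(Y = 1) − E[S]`. -/
theorem ece_eq_vece_of_consistently_underconfident
    {Ω : Type} [MeasurableSpace Ω] (P : Measure Ω) [IsProbabilityMeasure P]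
    (S Y V : Ω → ℝ)
    (hS : Measurable S) (hY : Measurable Y) (hV : Measurable V)
    (hSint : Integrable S P)
    (hY01 : ∀ ω, Y ω = 0 ∨ Y ω = 1)
    (hUnderS : ∀ᵐ ω ∂P, S ω < (P[Y | MeasurableSpace.comap S Real.measurableSpace]) ω)
    (hUnderV : ∀ᵐ ω ∂P, (P[S | MeasurableSpace.comap V Real.measurableSpace]) ω
                        < (P[Y | MeasurableSpace.comap V Real.measurableSpace]) ω) :
    (∫ ω, |(P[Y | MeasurableSpace.comap S Real.measurableSpace]) ω - S ω| ∂P)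
      = (∫ ω, |(P[Y | MeasurableSpace.comap V Real.measurableSpace]) ω
                - (P[S | MeasurableSpace.comap V Real.measurableSpace]) ω| ∂P) ∧
    (∫ ω, |(P[Y | MeasurableSpace.comap S Real.measurableSpace]) ω - S ω| ∂P)
      = (P {ω | Y ω = 1}).toReal - (∫ ω, S ω ∂P) := by
  rw [integral_abs_sub_of_ae_lt hSint integrable_condExp hUnderS,
    integral_abs_sub_of_ae_lt integrable_condExp integrable_condExp hUnderV,
    integral_condExp hS.comap_le, integral_condExp hV.comap_le, integral_condExp hV.comap_le,
    integral_eq_measure_eq_one hY hY01]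
  exact ⟨rfl, rfl⟩
end
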